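/- arXiv:2107.08308 — 2 statements merged into one kernel-verified Lean document; each statement's English description precedes it below -/
import Mathlib

section
/- Let a and b be coprime positive integers and let n be an integer with ab − a ≤ n < ab. Then the number of quadruples (x, y, z, u) of nonnegative integers satisfying ax + by + z + u = n equals (n+1)(n+2)/2 + (a−1)(b−1)(2ab − a − b − 6n − 7)/12. -/
theorem Nat.Coprime.eq_of_mul_modEq_of_lt {a b y y' : ℕ} (hab : Nat.Coprime a b)
    (hy : y < a) (hy' : y' < a) (h : b * y ≡ b * y' [MOD a]) : y = y' :=
  (Nat.ModEq.cancel_left_of_coprime hab h).eq_of_lt_of_lt hy hy'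

/-- Multiplication by a unit permutes the residues modulo `a`. -/
theorem Nat.Coprime.image_mul_mod_range {a b : ℕ} (ha : 0 < a) (hab : Nat.Coprime a b) :
    (Finset.range a).image (fun y => b * y % a) = Finset.range a := by
  apply Finset.eq_of_subset_of_card_le
  · intro r hr
    obtain ⟨y, -, rfl⟩ := Finset.mem_image.1 hr
    exact Finset.mem_range.2 (Nat.mod_lt _ ha)
  · rw [Finset.card_image_of_injOn]
    intro y hy y' hy' h
    exact hab.eq_of_mul_modEq_of_lt (by simpa using hy) (by simpa using hy') h

theorem Nat.Coprime.sum_mul_mod_range {a b : ℕ} (ha : 0 < a) (hab : Nat.Coprime a b)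
    (g : ℕ → ℚ) :
    ∑ y ∈ Finset.range a, g (b * y % a) = ∑ y ∈ Finset.range a, g y := by
  conv_rhs => rw [← hab.image_mul_mod_range ha]
  rw [Finset.sum_image]
  intro y hy y' hy' h
  exact hab.eq_of_mul_modEq_of_lt (by simpa using hy) (by simpa using hy') h

/-- A number below `a * b` has at most one representation `a * x + b * y`. -/
theorem Nat.Coprime.linear_combination_unique {a b x y x' y' : ℕ} (hab : Nat.Coprime a b)
    (h : a * x + b * y = a * x' + b * y') (hlt : a * x + b * y < a * b) :
    x = x' ∧ y = y' := by
  have ha : 0 < a := Nat.pos_of_mul_pos_right (by omega : 0 < a * b)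
  have hb : 0 < b := Nat.pos_of_mul_pos_left (by omega : 0 < a * b)
  have hy : y < a := by
    refine Nat.lt_of_mul_lt_mul_left (a := b) ?_
    rw [Nat.mul_comm b a]; omega
  have hy' : y' < a := by
    refine Nat.lt_of_mul_lt_mul_left (a := b) ?_
    rw [Nat.mul_comm b a]; omega
  have e : y = y' := by
    apply hab.eq_of_mul_modEq_of_lt hy hy'
    have := congrArg (· % a) h
    simpa [Nat.ModEq, Nat.add_mod] using this
  subst e
  exact ⟨Nat.eq_of_mul_eq_mul_left ha (by omega), rfl⟩

/-- Summation over the numbers not of the form `a * x + b * y`, sorted by residue modulo `a`. -/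
theorem Nat.Coprime.sum_gaps {a b n : ℕ} (ha : 0 < a) (hab : Nat.Coprime a b)
    (hn : a * b ≤ n + a + b) [DecidablePred fun m => ∃ x y, a * x + b * y = m] (g : ℕ → ℚ) :
    ∑ m ∈ (Finset.range (n + 1)).filter (fun m => ¬ ∃ x y, a * x + b * y = m), g m =
      ∑ y ∈ Finset.range a, ∑ j ∈ Finset.range (b * y / a), g (b * y % a + a * j) := by
  rw [Finset.sum_sigma']
  symm
  refine Finset.sum_bij (fun p _ => b * p.1 % a + a * p.2) ?_ ?_ ?_ (fun _ _ => rfl)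
  · rintro ⟨y, j⟩ hp
    simp only [Finset.mem_sigma, Finset.mem_range] at hp
    obtain ⟨hy, hj⟩ := hp
    have h1 : a * (j + 1) ≤ a * (b * y / a) := Nat.mul_le_mul_left a hj
    have h2 := Nat.mod_add_div (b * y) a
    have h3 : b * (y + 1) ≤ b * a := Nat.mul_le_mul_left b hy
    rw [Nat.mul_add] at h1 h3
    rw [Nat.mul_comm b a] at h3
    simp only [Finset.mem_filter, Finset.mem_range]
    refine ⟨by omega, ?_⟩
    rintro ⟨x', y', h⟩
    have h4 : b * y ≡ b * y' [MOD a] := by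
      have := congrArg (· % a) h
      simpa [Nat.ModEq, Nat.add_mod] using this.symm
    have h5 : y % a = y' % a := Nat.ModEq.cancel_left_of_coprime hab h4
    rw [Nat.mod_eq_of_lt hy] at h5
    have h6 : b * y ≤ b * y' := Nat.mul_le_mul_left b (h5 ▸ Nat.mod_le y' a)
    omega
  · rintro ⟨y, j⟩ hp ⟨y', j'⟩ hp' h
    simp only [Finset.mem_sigma, Finset.mem_range] at hp hp' h
    have e : y = y' := by
      apply hab.eq_of_mul_modEq_of_lt hp.1 hp'.1
      have := congrArg (· % a) h
      simpa [Nat.ModEq, Nat.add_mod] using this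
    subst e
    have : j = j' := Nat.eq_of_mul_eq_mul_left ha (by omega)
    rw [this]
  · intro m hm
    simp only [Finset.mem_filter, Finset.mem_range] at hm
    have h1 : m % a ∈ (Finset.range a).image (fun y => b * y % a) := by
      rw [hab.image_mul_mod_range ha]
      exact Finset.mem_range.2 (Nat.mod_lt _ ha)
    obtain ⟨y, hy, hym⟩ := Finset.mem_image.1 h1
    have h2 := Nat.mod_add_div m a
    have h3 := Nat.mod_add_div (b * y) a
    refine ⟨⟨y, m / a⟩, ?_, by simp only [hym]; exact h2⟩
    refine Finset.mem_sigma.2 ⟨hy, Finset.mem_range.2 ?_⟩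
    by_contra! hle
    dsimp only at hle hym
    refine hm.2 ⟨m / a - b * y / a, y, ?_⟩
    have h4 := Nat.mul_le_mul_left a hle
    rw [Nat.mul_sub]
    omega

theorem Finset.sum_range_cast_eq (k : ℕ) :
    ∑ i ∈ Finset.range k, (i : ℚ) = k * (k - 1) / 2 := by
  induction k with
  | zero => simp
  | succ k ih => rw [Finset.sum_range_succ, ih]; push_cast; ring

theorem Finset.sum_range_cast_sq_eq (k : ℕ) :
    ∑ i ∈ Finset.range k, (i : ℚ) ^ 2 = k * (k - 1) * (2 * k - 1) / 6 := by
  induction k with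
  | zero => simp
  | succ k ih => rw [Finset.sum_range_succ, ih]; push_cast; ring

/-- The sum of `c - m` over the numbers `m` not of the form `a * x + b * y`. -/
theorem Nat.Coprime.sum_gaps_sub {a b : ℕ} (ha : 0 < a) (hab : Nat.Coprime a b) (c : ℚ) :
    ∑ y ∈ Finset.range a, ∑ j ∈ Finset.range (b * y / a), (c - ((b * y % a + a * j : ℕ) : ℚ)) =
      ((a : ℚ) - 1) * (b - 1) * (6 * c - (2 * a * b - a - b - 1)) / 12 := by
  have ha' : (a : ℚ) ≠ 0 := by positivity
  have inner (y : ℕ) :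
      ∑ j ∈ Finset.range (b * y / a), (c - ((b * y % a + a * j : ℕ) : ℚ)) =
        ((2 * c + a) * b / (2 * a)) * (y : ℚ) - (b ^ 2 / (2 * a)) * (y : ℚ) ^ 2 -
          (((2 * c + a) / (2 * a)) * ((b * y % a : ℕ) : ℚ) -
            (1 / (2 * a)) * ((b * y % a : ℕ) : ℚ) ^ 2) := by
    have h : ((b * y % a : ℕ) : ℚ) + a * ((b * y / a : ℕ) : ℚ) = b * y := by
      exact_mod_cast Nat.mod_add_div (b * y) a
    push_cast only [Finset.sum_sub_distrib, Finset.sum_add_distrib, ← Finset.mul_sum,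
      Finset.sum_range_cast_eq, Finset.sum_const, Finset.card_range, nsmul_eq_mul,
      Nat.cast_add, Nat.cast_mul]
    generalize ((b * y % a : ℕ) : ℚ) = r at *
    generalize ((b * y / a : ℕ) : ℚ) = q at *
    obtain rfl : r = b * y - a * q := by linarith
    field_simp
    ring
  simp only [inner]
  rw [Finset.sum_sub_distrib, hab.sum_mul_mod_range ha
    (fun r => ((2 * c + a) / (2 * a)) * (r : ℚ) - (1 / (2 * a)) * (r : ℚ) ^ 2)]
  simp only [Finset.sum_sub_distrib, ← Finset.mul_sum, Finset.sum_range_cast_eq,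
    Finset.sum_range_cast_sq_eq]
  field_simp
  ring

theorem Nat.Coprime.card_quadruples {a b n : ℕ} (hab : Nat.Coprime a b) (hn : n < a * b)
    [DecidablePred fun m => ∃ x y, a * x + b * y = m] :
    Nat.card {p : ℕ × ℕ × ℕ × ℕ // a * p.1 + b * p.2.1 + p.2.2.1 + p.2.2.2 = n} =
      ∑ m ∈ (Finset.range (n + 1)).filter (fun m => ∃ x y, a * x + b * y = m), (n + 1 - m) := by
  let T := ((Finset.range (n + 1)).filter (fun m => ∃ x y, a * x + b * y = m)).sigma
    (fun m => Finset.range (n + 1 - m))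
  have hT : T.card = ∑ m ∈ (Finset.range (n + 1)).filter
      (fun m => ∃ x y, a * x + b * y = m), (n + 1 - m) := by
    simp [T, Finset.card_sigma]
  rw [← hT, ← Fintype.card_coe T, ← Nat.card_eq_fintype_card]
  refine Nat.card_eq_of_bijective
    (fun p => ⟨⟨a * p.1.1 + b * p.1.2.1, p.1.2.2.1⟩, ?_⟩) ⟨?_, ?_⟩
  · obtain ⟨⟨x, y, z, u⟩, h⟩ := p
    simp only at h
    simp only [T, Finset.mem_sigma, Finset.mem_filter, Finset.mem_range]
    exact ⟨⟨by omega, x, y, rfl⟩, by omega⟩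
  · rintro ⟨⟨x, y, z, u⟩, h⟩ ⟨⟨x', y', z', u'⟩, h'⟩ e
    simp only [Subtype.mk.injEq, Sigma.mk.injEq, heq_eq_eq] at h h' e
    obtain ⟨e, rfl⟩ := e
    obtain ⟨rfl, rfl⟩ := hab.linear_combination_unique e (by omega)
    obtain rfl : u = u' := by omega
    rfl
  · rintro ⟨⟨m, z⟩, h⟩
    simp only [T, Finset.mem_sigma, Finset.mem_filter, Finset.mem_range] at h
    obtain ⟨⟨hm, x, y, rfl⟩, hz⟩ := h
    exact ⟨⟨(x, y, z, n - (a * x + b * y) - z), by simp only; omega⟩, rfl⟩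

theorem stmt_0 (a b : ℕ) (ha : 0 < a) (hb : 0 < b) (hab : Nat.Coprime a b)
    (n : ℕ) (hn₁ : a * b - a ≤ n) (hn₂ : n < a * b) :
    (Nat.card {p : ℕ × ℕ × ℕ × ℕ //
        a * p.1 + b * p.2.1 + p.2.2.1 + p.2.2.2 = n} : ℚ) =
      ((n : ℚ) + 1) * ((n : ℚ) + 2) / 2 +
        ((a : ℚ) - 1) * ((b : ℚ) - 1) *
          (2 * (a : ℚ) * (b : ℚ) - (a : ℚ) - (b : ℚ) - 6 * (n : ℚ) - 7) / 12 := by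
  classical
  have hcast : ((∑ m ∈ (Finset.range (n + 1)).filter (fun m => ∃ x y, a * x + b * y = m),
      (n + 1 - m) : ℕ) : ℚ) =
      ∑ m ∈ (Finset.range (n + 1)).filter (fun m => ∃ x y, a * x + b * y = m),
        (((n : ℚ) + 1) - (m : ℚ)) := by
    rw [Nat.cast_sum]
    refine Finset.sum_congr rfl fun m hm => ?_
    have := Finset.mem_range.1 (Finset.mem_filter.1 hm).1
    rw [Nat.cast_sub this.le]
    push_cast
    rfl
  have hsplit := Finset.sum_filter_add_sum_filter_not (Finset.range (n + 1))
    (fun m => ∃ x y, a * x + b * y = m) (fun m => ((n : ℚ) + 1) - (m : ℚ))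
  rw [hab.sum_gaps ha (by omega), hab.sum_gaps_sub ha,
    Finset.sum_sub_distrib (s := Finset.range (n + 1)), Finset.sum_range_cast_eq, Finset.sum_const, Finset.card_range, nsmul_eq_mul] at hsplit
  push_cast at hsplit
  rw [hab.card_quadruples hn₂, hcast]
  linear_combination hsplit
end

section
/- Let a and b be coprime positive integers. Then the set NR(a,b) of nonnegative integers n that cannot be expressed as n = ax + by with nonnegative integers x, y is finite and has exactly (a−1)(b−1)/2 elements. -/
theorem Int.exists_eq_mul_add_mul_of_coprime {a b : ℕ} (hb : 0 < b) (hab : Nat.Coprime a b)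
    (n : ℤ) : ∃ x y : ℤ, 0 ≤ x ∧ x < b ∧ n = a * x + b * y := by
  have hbez : (1 : ℤ) = a * Nat.gcdA a b + b * Nat.gcdB a b := by
    rw [← Nat.gcd_eq_gcd_ab, hab.gcd_eq_one, Nat.cast_one]
  have hb' : (0 : ℤ) < b := by exact_mod_cast hb
  refine ⟨n * Nat.gcdA a b % b, n * Nat.gcdB a b + a * (n * Nat.gcdA a b / b),
    Int.emod_nonneg _ hb'.ne', Int.emod_lt_of_pos _ hb', ?_⟩
  linear_combination n * hbez - a * Int.emod_add_mul_ediv (n * Nat.gcdA a b) b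

theorem Nat.exists_eq_mul_add_mul_of_le {a b : ℕ} (ha : 0 < a) (hb : 0 < b)
    (hab : Nat.Coprime a b) {n : ℕ} (hn : (a - 1) * (b - 1) ≤ n) :
    ∃ x y : ℕ, n = a * x + b * y := by
  obtain ⟨x, y, hx, hxb, h⟩ := Int.exists_eq_mul_add_mul_of_coprime hb hab n
  have hy : 0 ≤ y := by
    zify [Nat.succ_le_of_lt ha, Nat.succ_le_of_lt hb] at hn
    have hax : (a : ℤ) * x ≤ a * (b - 1) := by gcongr; omega
    by_contra! hy
    have hby : (b : ℤ) * y ≤ b * (-1) := by gcongr; omega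
    linarith
  lift x to ℕ using hx
  lift y to ℕ using hy
  exact ⟨x, y, by exact_mod_cast h⟩

/-- The reflection `n ↦ (a - 1) * (b - 1) - 1 - n` exchanges representable and
non-representable numbers. -/
theorem Nat.exists_eq_mul_add_mul_iff_not {a b : ℕ} (ha : 0 < a) (hb : 0 < b)
    (hab : Nat.Coprime a b) {n m : ℕ} (hnm : n + m + 1 = (a - 1) * (b - 1)) :
    (∃ x y : ℕ, m = a * x + b * y) ↔ ¬ ∃ x y : ℕ, n = a * x + b * y := by
  zify [Nat.succ_le_of_lt ha, Nat.succ_le_of_lt hb] at hnm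
  constructor
  · rintro ⟨x, y, h⟩ ⟨x', y', h'⟩
    refine Nat.Coprime.mul_add_mul_ne_mul hab (Nat.succ_ne_zero (x + x'))
      (Nat.succ_ne_zero (y + y')) ?_
    zify at h h' ⊢
    linear_combination hnm - h - h'
  · intro hn
    obtain ⟨x, y, hx, hxb, h⟩ := Int.exists_eq_mul_add_mul_of_coprime hb hab n
    have hy : y < 0 := by
      by_contra! hy
      lift x to ℕ using hx
      lift y to ℕ using hy
      exact hn ⟨x, y, by exact_mod_cast h⟩
    refine ⟨(b - 1 - x).toNat, (-1 - y).toNat, ?_⟩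
    zify
    rw [Int.toNat_of_nonneg (by omega), Int.toNat_of_nonneg (by omega)]
    linear_combination hnm - h

theorem stmt_9 (a b : ℕ) (ha : 0 < a) (hb : 0 < b) (hab : Nat.Coprime a b) :
    {n : ℕ | ¬ ∃ x y : ℕ, n = a * x + b * y}.Finite ∧
      {n : ℕ | ¬ ∃ x y : ℕ, n = a * x + b * y}.ncard = (a - 1) * (b - 1) / 2 := by
  classical
  set N := (a - 1) * (b - 1)
  set P : ℕ → Prop := fun n => ∃ x y : ℕ, n = a * x + b * y
  have hset : {n : ℕ | ¬ P n} = ((Finset.range N).filter fun n => ¬ P n : Finset ℕ) := by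
    ext n
    simp only [Set.mem_ofPred_eq, Finset.coe_filter, Finset.mem_range]
    refine ⟨fun h => ⟨?_, h⟩, fun h => h.2⟩
    by_contra! hn
    exact h (Nat.exists_eq_mul_add_mul_of_le ha hb hab hn)
  have hrefl {n : ℕ} (hn : n < N) : P (N - 1 - n) ↔ ¬ P n :=
    Nat.exists_eq_mul_add_mul_iff_not ha hb hab (by omega)
  have hcard : ((Finset.range N).filter P).card =
      ((Finset.range N).filter fun n => ¬ P n).card := by
    refine Finset.card_nbij' (fun n => N - 1 - n) (fun n => N - 1 - n) ?_ ?_ ?_ ?_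
    · intro n hn
      simp only [Finset.coe_filter, Finset.mem_range, Set.mem_ofPred_eq] at hn ⊢
      exact ⟨by omega, fun h => (hrefl hn.1).1 h hn.2⟩
    · intro n hn
      simp only [Finset.coe_filter, Finset.mem_range, Set.mem_ofPred_eq] at hn ⊢
      exact ⟨by omega, (hrefl hn.1).2 hn.2⟩
    all_goals
      intro n hn
      simp only [Finset.coe_filter, Finset.mem_range, Set.mem_ofPred_eq] at hn
      have := hn.1
      dsimp only
      omega
  have hsum := Finset.card_filter_add_card_filter_not (s := Finset.range N) P
  rw [Finset.card_range] at hsum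
  change {n : ℕ | ¬ P n}.Finite ∧ {n : ℕ | ¬ P n}.ncard = N / 2
  rw [hset]
  refine ⟨Finset.finite_toSet _, ?_⟩
  rw [Set.ncard_coe_finset]
  omega
end
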